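/- Fix a dimension d ≥ 1, a time step Δt > 0, mesh widths Δx_l > 0 (l = 1,…,d), and nondecreasing flux functions f_l : ℝ → ℝ. Let u^n : ℤ^d → ℝ (n ∈ ℕ) and q^n : ℤ^d → ℝ (n ≥ 1) satisfy the implicit upwind scheme: for all n ∈ ℕ and j ∈ ℤ^d, u_j^{n+1} = u_j^n − Σ_{l=1}^d (Δt/Δx_l)(f_l(u_j^{n+1}) − f_l(u_{j−e_l}^{n+1})) + Δt·q_j^{n+1}. Let φ : ℕ × ℤ^d → ℝ be nonnegative with finite support, and let k ∈ ℝ. Then the summed (weak) discrete entropy inequality holds: −Σ_{j∈ℤ^d} |u_j^0 − k|·φ_j^0 − Δt·Σ_{j∈ℤ^d} Σ_{n≥0} sgn(u_j^{n+1} − k)·q_j^{n+1}·φ_j^{n+1} ≤ Δt·Σ_{j∈ℤ^d} Σ_{n≥0} [ |u_j^n − k|·(φ_j^{n+1} − φ_j^n)/Δt + sgn(u_j^{n+1} − k)·Σ_{l=1}^d (f_l(u_j^{n+1}) − f_l(k))·(φ_{j+e_l}^{n+1} − φ_j^{n+1})/Δx_l ], where sgn is the sign function with sgn(0) = 0. 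-/

import Mathlib

open scoped BigOperators

/-- A finitely supported function of two variables sums to its iterated `finsum`. -/
theorem hasSum_finsum_finsum {α β : Type*} {F : α → β → ℝ}
    (hF : (Function.support fun p : α × β => F p.1 p.2).Finite) :
    HasSum (fun p : α × β => F p.1 p.2) (∑ᶠ a, ∑ᶠ b, F a b) := by
  rw [← finsum_curry (fun p : α × β => F p.1 p.2) hF,
    ← tsum_eq_finsum (L := .unconditional _) hF]
  exact (summable_of_hasFiniteSupport hF).hasSum

theorem finsum_succ_sub_self {a : ℕ → ℝ} (ha : a.support.Finite) :
    ∑ᶠ n, (a (n + 1) - a n) = -a 0 := by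
  have hsucc : (Function.support fun n => a (n + 1)).Finite :=
    ha.preimage (add_left_injective 1).injOn
  have hsum : Summable a := summable_of_hasFiniteSupport ha
  rw [finsum_sub_distrib hsucc ha, ← tsum_eq_finsum (L := .unconditional _) hsucc,
    ← tsum_eq_finsum (L := .unconditional _) ha,
    hsum.tsum_eq_zero_add]
  ring

/-- Telescoping in the second variable of a finitely supported function. -/
theorem hasSum_succ_sub_self {α : Type*} {a : α → ℕ → ℝ}
    (ha : (Function.support fun p : α × ℕ => a p.1 p.2).Finite) :
    HasSum (fun p : α × ℕ => a p.1 (p.2 + 1) - a p.1 p.2) (-∑ᶠ j, a j 0) := by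
  have hsucc : (Function.support fun p : α × ℕ => a p.1 (p.2 + 1)).Finite :=
    ha.preimage (f := Prod.map id (· + 1))
      (Function.injective_id.prodMap (add_left_injective 1)).injOn
  have h := hasSum_finsum_finsum (F := fun j n => a j (n + 1) - a j n)
    ((hsucc.union ha).subset (Function.support_sub _ _))
  have hrow (j : α) : (a j).support.Finite :=
    ha.preimage (f := Prod.mk j) (Prod.mk_right_injective j).injOn
  simpa only [finsum_succ_sub_self (hrow _), finsum_neg_distrib] using h

/-- The difference of a finitely supported function and its translate sums to zero. -/
theorem hasSum_comp_equiv_sub_self {α : Type*} (σ : α ≃ α) {a : α → ℝ}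
    (ha : a.support.Finite) : HasSum (fun p => a (σ p) - a p) 0 := by
  have h : HasSum a _ := (summable_of_hasFiniteSupport ha).hasSum
  simpa using (σ.hasSum_iff.mpr h).sub h

theorem Real.sign_mul_le_abs (x y : ℝ) : Real.sign x * y ≤ |y| := by
  rcases Real.sign_apply_eq x with h | h | h <;> rw [h]
  · simpa using neg_le_abs y
  · simp
  · simpa using le_abs_self y

theorem Real.sign_mul_self_eq_abs (x : ℝ) : Real.sign x * x = |x| := by
  rcases lt_trichotomy x 0 with h | rfl | h
  · simp [Real.sign_of_neg h, abs_of_neg h]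
  · simp
  · simp [Real.sign_of_pos h, abs_of_pos h]

theorem Monotone.sign_mul_sub_eq_abs {g : ℝ → ℝ} (hg : Monotone g) (v k : ℝ) :
    Real.sign (v - k) * (g v - g k) = |g v - g k| := by
  rcases lt_trichotomy v k with h | rfl | h
  · rw [Real.sign_of_neg (sub_neg.mpr h), abs_of_nonpos (sub_nonpos.mpr (hg h.le))]
    ring
  · simp
  · rw [Real.sign_of_pos (sub_pos.mpr h), abs_of_nonneg (sub_nonneg.mpr (hg h.le)), one_mul]

/-- The pointwise discrete entropy inequality of an implicit upwind step from `w` to `v`, where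
`z l` is the upwind neighbour of `v` in direction `l` and `c l` is the mesh ratio. -/
theorem implicit_upwind_entropy_step {ι : Type*} [Fintype ι] {f : ι → ℝ → ℝ}
    (hf : ∀ l, Monotone (f l)) {c : ι → ℝ} (hc : ∀ l, 0 ≤ c l) {v w r : ℝ} {z : ι → ℝ}
    (h : v = w - (∑ l, c l * (f l v - f l (z l))) + r) (k : ℝ) :
    |v - k| ≤ |w - k|
      - (∑ l, c l * (Real.sign (v - k) * (f l v - f l k)
          - Real.sign (z l - k) * (f l (z l) - f l k)))
      + Real.sign (v - k) * r := by
  have hflux : ∑ l, c l * (Real.sign (v - k) * (f l v - f l k)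
        - Real.sign (z l - k) * (f l (z l) - f l k))
      ≤ Real.sign (v - k) * ∑ l, c l * (f l v - f l (z l)) := by
    rw [Finset.mul_sum]
    refine Finset.sum_le_sum fun l _ => ?_
    rw [(hf l).sign_mul_sub_eq_abs (z l)]
    have := mul_le_mul_of_nonneg_left
      (Real.sign_mul_le_abs (v - k) (f l (z l) - f l k)) (hc l)
    linarith
  have hw := Real.sign_mul_le_abs (v - k) (w - k)
  have hv : |v - k| = Real.sign (v - k) * (w - k)
      - Real.sign (v - k) * (∑ l, c l * (f l v - f l (z l))) + Real.sign (v - k) * r := by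
    rw [← Real.sign_mul_self_eq_abs, ← mul_sub, ← mul_add]
    congr 1
    linarith
  linarith

/-- Inequality (43) in the proof of Theorem 4: the summed (weak) form of the
discrete entropy inequality for the implicit upwind scheme with nondecreasing
fluxes, tested against a nonnegative finitely supported discrete test function. -/
theorem implicit_upwind_weak_discrete_entropy_inequality
    (d : ℕ) (hd : 1 ≤ d) (Δt : ℝ) (hΔt : 0 < Δt)
    (Δx : Fin d → ℝ) (hΔx : ∀ l, 0 < Δx l)
    (f : Fin d → ℝ → ℝ) (hf : ∀ l, Monotone (f l))
    (e : Fin d → (Fin d → ℤ)) (he : ∀ l, e l = Pi.single l 1)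
    (u q : ℕ → (Fin d → ℤ) → ℝ)
    (hscheme : ∀ (n : ℕ) (j : Fin d → ℤ),
      u (n + 1) j = u n j
        - (∑ l : Fin d, (Δt / Δx l) *
            (f l (u (n + 1) j) - f l (u (n + 1) (j - e l))))
        + Δt * q (n + 1) j)
    (φ : ℕ → (Fin d → ℤ) → ℝ)
    (hφpos : ∀ n j, 0 ≤ φ n j)
    (hφsupp : (Function.support fun p : ℕ × (Fin d → ℤ) => φ p.1 p.2).Finite)
    (k : ℝ) :
    -(∑ᶠ j : Fin d → ℤ, |u 0 j - k| * φ 0 j)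
      - Δt * (∑ᶠ j : Fin d → ℤ, ∑ᶠ n : ℕ,
          Real.sign (u (n + 1) j - k) * q (n + 1) j * φ (n + 1) j)
    ≤ Δt * (∑ᶠ j : Fin d → ℤ, ∑ᶠ n : ℕ,
        (|u n j - k| * ((φ (n + 1) j - φ n j) / Δt)
          + Real.sign (u (n + 1) j - k) *
              ∑ l : Fin d, (f l (u (n + 1) j) - f l k) *
                ((φ (n + 1) (j + e l) - φ (n + 1) j) / Δx l))) := by
  have hcomp (g : (Fin d → ℤ) × ℕ → ℕ × (Fin d → ℤ)) (hg : g.Injective) :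
      (Function.support fun p => φ (g p).1 (g p).2).Finite := hφsupp.preimage hg.injOn
  have hφ₀ : (Function.support fun p : (Fin d → ℤ) × ℕ => φ p.2 p.1).Finite :=
    hcomp Prod.swap Prod.swap_injective
  have hφ₁ : (Function.support fun p : (Fin d → ℤ) × ℕ => φ (p.2 + 1) p.1).Finite :=
    hcomp (fun p => (p.2 + 1, p.1)) fun p p' h => by
      simp only [Prod.mk.injEq, add_left_inj] at h
      exact Prod.ext h.2 h.1
  have hφ₂ (l : Fin d) :
      (Function.support fun p : (Fin d → ℤ) × ℕ => φ (p.2 + 1) (p.1 + e l)).Finite :=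
    hcomp (fun p => (p.2 + 1, p.1 + e l)) fun p p' h => by
      simp only [Prod.mk.injEq, add_left_inj] at h
      exact Prod.ext h.2 h.1
  have hA := hasSum_succ_sub_self (a := fun j n => |u n j - k| * φ n j)
    (hφ₀.subset (Function.support_mul_subset_right _ _))
  have hQ := hasSum_finsum_finsum
    (F := fun j n => Real.sign (u (n + 1) j - k) * q (n + 1) j * φ (n + 1) j)
    (hφ₁.subset (Function.support_mul_subset_right _ _))
  have hR := hasSum_finsum_finsum
    (F := fun j n => |u n j - k| * ((φ (n + 1) j - φ n j) / Δt)
      + Real.sign (u (n + 1) j - k) *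
          ∑ l : Fin d, (f l (u (n + 1) j) - f l k) *
            ((φ (n + 1) (j + e l) - φ (n + 1) j) / Δx l)) (by
    refine ((hφ₀.union hφ₁).union (Set.finite_iUnion hφ₂)).subset fun p hp => ?_
    contrapose! hp
    simp only [Set.mem_union, Set.mem_iUnion, Function.mem_support, not_or, not_exists,
      not_not] at hp
    simp [hp.1.1, hp.1.2, hp.2])
  have hZ (l : Fin d) := hasSum_comp_equiv_sub_self
    ((Equiv.addRight (e l)).prodCongr (Equiv.refl ℕ))
    (a := fun p : (Fin d → ℤ) × ℕ =>
      Real.sign (u (p.2 + 1) (p.1 - e l) - k) * (f l (u (p.2 + 1) (p.1 - e l)) - f l k) / Δx l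
        * φ (p.2 + 1) p.1)
    (hφ₁.subset (Function.support_mul_subset_right _ _))
  have hL := hA.sub (hQ.mul_left Δt)
  have hRZ := (hR.mul_left Δt).sub ((hasSum_sum fun l (_ : l ∈ Finset.univ) => hZ l).mul_left Δt)
  simp only [Finset.sum_const_zero, mul_zero, sub_zero] at hRZ
  refine hasSum_le (fun p => ?_) hL hRZ
  obtain ⟨j, n⟩ := p
  have hstep := mul_le_mul_of_nonneg_right
    (implicit_upwind_entropy_step hf (fun l => (div_pos hΔt (hΔx l)).le) (hscheme n j) k)
    (hφpos (n + 1) j)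
  simp only [Equiv.prodCongr_apply, Prod.map_apply, Equiv.coe_addRight, Equiv.refl_apply,
    add_sub_cancel_right]
  have htime : Δt * (|u n j - k| * ((φ (n + 1) j - φ n j) / Δt))
      = |u n j - k| * (φ (n + 1) j - φ n j) := by
    field_simp
  have hspace : (∑ l, Δt / Δx l * (Real.sign (u (n + 1) j - k) * (f l (u (n + 1) j) - f l k)
        - Real.sign (u (n + 1) (j - e l) - k) * (f l (u (n + 1) (j - e l)) - f l k)))
          * φ (n + 1) j
      = Δt * (∑ l, (Real.sign (u (n + 1) j - k) * (f l (u (n + 1) j) - f l k) / Δx l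
            * φ (n + 1) (j + e l)
          - Real.sign (u (n + 1) (j - e l) - k) * (f l (u (n + 1) (j - e l)) - f l k) / Δx l
            * φ (n + 1) j))
        - Δt * (Real.sign (u (n + 1) j - k) * ∑ l, (f l (u (n + 1) j) - f l k) *
          ((φ (n + 1) (j + e l) - φ (n + 1) j) / Δx l)) := by
    simp only [Finset.mul_sum, Finset.sum_mul, ← Finset.sum_sub_distrib]
    refine Finset.sum_congr rfl fun l _ => ?_
    ring
  linarith
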